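/- Consider switched-system data as in the context, with symmetric positive definite matrices P_p ∈ ℝ^{d×d} and constants λ̂_p ∈ ℝ for p ∈ P (with λ̂_p > 0 for p ∈ P_S and λ̂_p ≤ 0 for p ∈ P_U) such that ⟨P_p exp(A_p s) ξ, exp(A_p s) ξ⟩ ≤ exp(−λ̂_p s) ⟨P_p ξ, ξ⟩ for all s ≥ 0 and ξ ∈ ℝ^d, and constants μ̂_{pq} ≥ 1 for (p,q) ∈ E(P) such that ⟨P_q ξ, ξ⟩ ≤ μ̂_{pq} ⟨P_p ξ, ξ⟩ for all ξ ∈ ℝ^d. If limsup_{t→+∞} [ ν(t) · Σ_{(p,q)∈E(P)} (ln μ̂_{pq}) ρ_{pq}(t) − Σ_{p∈P_S} |λ̂_p| η_p(t) + Σ_{p∈P_U} |λ̂_p| η_p(t) ] < 0, then the switched system is globally asymptotically stable for this switching signal, i.e.: (Lyapunov stability) for every ε > 0 there exists δ > 0 such that ‖x₀‖ < δ implies ‖x(t)‖ ≤ ε for all t ≥ 0; and (global asymptotic convergence) for every x₀ ∈ ℝ^d, ‖x(t)‖ → 0 as t → +∞. -/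

import Mathlib

open Matrix Filter

attribute [local instance] Matrix.linftyOpNormedRing Matrix.linftyOpNormedAlgebra

/-- `prodFlow A σ τ k` is the state-transition matrix
`exp(A_{σ(k-1)}(τ_k − τ_{k-1})) ⋯ exp(A_{σ_0}(τ_1 − τ_0))`. -/
noncomputable def prodFlow {d : ℕ} {P : Type*} (A : P → Matrix (Fin d) (Fin d) ℝ)
    (σ : ℕ → P) (τ : ℕ → ℝ) : ℕ → Matrix (Fin d) (Fin d) ℝ
  | 0 => 1
  | (k + 1) => NormedSpace.exp ((τ (k + 1) - τ k) • A (σ k)) * prodFlow A σ τ k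

/-- In `ℝ`, a negative `limsup` is not a junk value, since `sInf ∅ = 0`. -/
theorem exists_neg_eventually_le_of_limsup_neg {α : Type*} {l : Filter α} {f : α → ℝ}
    (h : limsup f l < 0) : ∃ a < 0, ∀ᶠ t in l, f t ≤ a := by
  rw [limsup_eq] at h
  have hne : {a | ∀ᶠ t in l, f t ≤ a}.Nonempty := by
    by_contra hempty
    rw [Set.not_nonempty_iff_eq_empty] at hempty
    rw [hempty, Real.sInf_empty] at h
    exact lt_irrefl _ h
  obtain ⟨a, ha, ha0⟩ := exists_lt_of_csInf_lt hne h
  exact ⟨a, ha0, ha⟩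

theorem exists_quadForm_bounds {d : ℕ} {P : Type*} [Fintype P]
    (Pm : P → Matrix (Fin d) (Fin d) ℝ) (hPm : ∀ p, (Pm p).PosDef) :
    ∃ c C : ℝ, 0 < c ∧ 0 < C ∧ ∀ p, ∀ ξ : Fin d → ℝ,
      c * ‖(WithLp.equiv 2 (Fin d → ℝ)).symm ξ‖ ^ 2 ≤ (Pm p).mulVec ξ ⬝ᵥ ξ ∧
      (Pm p).mulVec ξ ⬝ᵥ ξ ≤ C * ‖(WithLp.equiv 2 (Fin d → ℝ)).symm ξ‖ ^ 2 := by
  have bounds_single : ∀ p, ∃ c C : ℝ, 0 < c ∧ 0 < C ∧ ∀ x : EuclideanSpace ℝ (Fin d),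
      c * ‖x‖ ^ 2 ≤ (Pm p).mulVec x.ofLp ⬝ᵥ x.ofLp ∧
      (Pm p).mulVec x.ofLp ⬝ᵥ x.ofLp ≤ C * ‖x‖ ^ 2 := by
    intro p
    have hcont : Continuous fun x : EuclideanSpace ℝ (Fin d) =>
        (Pm p).mulVec x.ofLp ⬝ᵥ x.ofLp := by fun_prop
    have hsphere : IsCompact (Metric.sphere (0 : EuclideanSpace ℝ (Fin d)) 1) :=
      isCompact_sphere _ _
    have hpos : ∀ x ∈ Metric.sphere (0 : EuclideanSpace ℝ (Fin d)) 1,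
        0 < (Pm p).mulVec x.ofLp ⬝ᵥ x.ofLp := by
      intro x hx
      have hne : x.ofLp ≠ 0 := by
        intro h
        have h0 : x = 0 := by ext i; simp [h]
        simp [h0] at hx
      have := (hPm p).dotProduct_mulVec_pos hne
      rwa [star_trivial, dotProduct_comm] at this
    obtain ⟨c, hc, hcle⟩ := hsphere.exists_forall_le' hcont.continuousOn hpos
    obtain ⟨C, hC⟩ := hsphere.exists_bound_of_continuousOn hcont.continuousOn
    refine ⟨c, max C 1, hc, by positivity, fun x => ?_⟩
    by_cases hx : x = 0
    · simp [hx]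
    have hn : ‖x‖ ≠ 0 := norm_ne_zero_iff.mpr hx
    have hmem : ‖x‖⁻¹ • x ∈ Metric.sphere (0 : EuclideanSpace ℝ (Fin d)) 1 := by
      simp [norm_smul, hn]
    have hscale : (Pm p).mulVec x.ofLp ⬝ᵥ x.ofLp = ((Pm p).mulVec (‖x‖⁻¹ • x).ofLp ⬝ᵥ
        (‖x‖⁻¹ • x).ofLp) * ‖x‖ ^ 2 := by
      simp only [WithLp.ofLp_smul, mulVec_smul, smul_dotProduct, dotProduct_smul, smul_eq_mul]
      field_simp
    rw [hscale]
    constructor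
    · gcongr
      exact hcle _ hmem
    · gcongr
      exact ((le_abs_self _).trans (hC _ hmem)).trans (le_max_left _ _)
  choose c C hc hC h using bounds_single
  rcases isEmpty_or_nonempty P with hP | hP
  · exact ⟨1, 1, one_pos, one_pos, fun p => hP.elim p⟩
  obtain ⟨p₁, hp₁⟩ := Finite.exists_min c
  obtain ⟨p₂, hp₂⟩ := Finite.exists_max C
  refine ⟨c p₁, C p₂, hc _, hC _, fun p ξ => ?_⟩
  have hb := h p ((WithLp.equiv 2 (Fin d → ℝ)).symm ξ)
  exact ⟨(mul_le_mul_of_nonneg_right (hp₁ p) (sq_nonneg _)).trans hb.1,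
    hb.2.trans (mul_le_mul_of_nonneg_right (hp₂ p) (sq_nonneg _))⟩

/-- The logarithmic gain of the multiple Lyapunov functions across the first `k` switches. -/
noncomputable def logGain {P : Type*} (σ : ℕ → P) (τ : ℕ → ℝ) (lam : P → ℝ) (mu : P × P → ℝ)
    (k : ℕ) : ℝ :=
  ∑ i ∈ Finset.range k,
    (Real.log (mu (σ i, σ (i + 1))) - lam (σ i) * (τ (i + 1) - τ i))

theorem quadForm_prodFlow_le {d : ℕ} {P : Type*}
    (A : P → Matrix (Fin d) (Fin d) ℝ) (E : Finset (P × P))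
    (τ : ℕ → ℝ) (hτmono : StrictMono τ) (σ : ℕ → P) (hσE : ∀ k, (σ k, σ (k + 1)) ∈ E)
    (Pm : P → Matrix (Fin d) (Fin d) ℝ) (lam : P → ℝ)
    (hlam : ∀ p, ∀ s : ℝ, 0 ≤ s → ∀ ξ : Fin d → ℝ,
      (Pm p).mulVec ((NormedSpace.exp (s • A p)).mulVec ξ) ⬝ᵥ
          (NormedSpace.exp (s • A p)).mulVec ξ ≤
        Real.exp (-(lam p) * s) * ((Pm p).mulVec ξ ⬝ᵥ ξ))
    (mu : P × P → ℝ) (hmuone : ∀ e ∈ E, 1 ≤ mu e)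
    (hmu : ∀ e ∈ E, ∀ ξ : Fin d → ℝ,
      (Pm e.2).mulVec ξ ⬝ᵥ ξ ≤ mu e * ((Pm e.1).mulVec ξ ⬝ᵥ ξ))
    (x₀ : Fin d → ℝ) (k : ℕ) :
    (Pm (σ k)).mulVec ((prodFlow A σ τ k).mulVec x₀) ⬝ᵥ (prodFlow A σ τ k).mulVec x₀ ≤
      Real.exp (logGain σ τ lam mu k) * ((Pm (σ 0)).mulVec x₀ ⬝ᵥ x₀) := by
  induction k with
  | zero => simp [prodFlow, logGain]
  | succ k ih =>
    have hmupos : 0 < mu (σ k, σ (k + 1)) := one_pos.trans_le (hmuone _ (hσE k))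
    have hgain : Real.exp (logGain σ τ lam mu (k + 1)) = mu (σ k, σ (k + 1)) *
        (Real.exp (-lam (σ k) * (τ (k + 1) - τ k)) * Real.exp (logGain σ τ lam mu k)) := by
      rw [logGain, Finset.sum_range_succ, ← logGain, ← Real.exp_add]
      nth_rewrite 2 [← Real.exp_log hmupos]
      rw [← Real.exp_add]
      congr 1
      ring
    rw [prodFlow, ← mulVec_mulVec, hgain, mul_assoc, mul_assoc]
    refine (hmu _ (hσE k) _).trans (mul_le_mul_of_nonneg_left ?_ hmupos.le)
    exact (hlam _ _ (sub_nonneg.mpr (hτmono k.lt_succ_self).le) _).trans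
      (mul_le_mul_of_nonneg_left ih (Real.exp_nonneg _))

theorem sum_mul_transition_count {P : Type*} [DecidableEq P] (E : Finset (P × P)) (σ : ℕ → P)
    (hσE : ∀ k, (σ k, σ (k + 1)) ∈ E) (w : P × P → ℝ) (n : ℕ) :
    ∑ e ∈ E, w e *
        (((Finset.range n).filter (fun i => σ i = e.1 ∧ σ (i + 1) = e.2)).card : ℝ) =
      ∑ i ∈ Finset.range n, w (σ i, σ (i + 1)) := by
  simp only [Finset.card_filter, Nat.cast_sum, Finset.mul_sum]
  rw [Finset.sum_comm]
  refine Finset.sum_congr rfl fun i _ => ?_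
  rw [Finset.sum_eq_single (σ i, σ (i + 1))]
  · simp
  · intro e _ he
    have : ¬ (σ i = e.1 ∧ σ (i + 1) = e.2) := fun h => he (Prod.ext h.1.symm h.2.symm)
    simp [this]
  · exact fun h => (h (hσE i)).elim

theorem signed_activation_sum {P : Type*} [Fintype P] [DecidableEq P]
    (PS PU : Finset P) (hpart : ∀ p, p ∈ PS ↔ p ∉ PU) (lam : P → ℝ)
    (hlamS : ∀ p ∈ PS, 0 < lam p) (hlamU : ∀ p ∈ PU, lam p ≤ 0)
    (σ : ℕ → P) (D : ℕ → ℝ) (n : ℕ) :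
    - ∑ p ∈ PS, |lam p| * (∑ i ∈ Finset.range n, if σ i = p then D i else 0)
      + ∑ p ∈ PU, |lam p| * (∑ i ∈ Finset.range n, if σ i = p then D i else 0) =
      - ∑ i ∈ Finset.range n, lam (σ i) * D i := by
  have hPS : PS = PUᶜ := by ext p; simp [hpart]
  have hS : ∑ p ∈ PS, |lam p| * (∑ i ∈ Finset.range n, if σ i = p then D i else 0) =
      ∑ p ∈ PUᶜ, lam p * (∑ i ∈ Finset.range n, if σ i = p then D i else 0) := by
    rw [← hPS]
    exact Finset.sum_congr rfl fun p hp => by rw [abs_of_pos (hlamS p hp)]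
  have hU : ∑ p ∈ PU, |lam p| * (∑ i ∈ Finset.range n, if σ i = p then D i else 0) =
      - ∑ p ∈ PU, lam p * (∑ i ∈ Finset.range n, if σ i = p then D i else 0) := by
    rw [← Finset.sum_neg_distrib]
    exact Finset.sum_congr rfl fun p hp => by rw [abs_of_nonpos (hlamU p hp), neg_mul]
  rw [hS, hU, ← neg_add, add_comm, Finset.sum_add_sum_compl]
  simp only [Finset.mul_sum]
  rw [Finset.sum_comm]
  simp

/-- **Theorem (stabilizing switching signals).**  If the limsup, as `t → +∞`, of
`ν(t) Σ_{(p,q)∈E} (ln μ̂_{pq}) ρ_{pq}(t) − Σ_{p∈P_S} |λ̂_p| η_p(t) + Σ_{p∈P_U} |λ̂_p| η_p(t)`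
is strictly negative, then the switched linear system is globally asymptotically stable:
Lyapunov stable and globally asymptotically convergent (in the Euclidean norm). -/
theorem stabilizing_switching
    {d : ℕ} {P : Type*} [Fintype P] [DecidableEq P]
    -- the partition P = P_S ⊔ P_U
    (PS PU : Finset P) (hpart : ∀ p, p ∈ PS ↔ p ∉ PU)
    -- subsystem matrices and admissible transitions
    (A : P → Matrix (Fin d) (Fin d) ℝ) (E : Finset (P × P))
    -- the switching signal: switching instants and active indices
    (τ : ℕ → ℝ) (hτ0 : τ 0 = 0) (hτmono : StrictMono τ)
    (hτtop : Tendsto τ atTop atTop)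
    (σ : ℕ → P) (hσE : ∀ k, (σ k, σ (k + 1)) ∈ E)
    -- N t = number of switching instants in (0, t]
    (N : ℝ → ℕ) (hN : ∀ t : ℝ, 0 ≤ t → ∀ k, (τ k ≤ t ↔ k ≤ N t))
    -- multiple Lyapunov-like functions: matrices P_p and constants λ̂_p
    (Pm : P → Matrix (Fin d) (Fin d) ℝ) (hPm : ∀ p, (Pm p).PosDef)
    (lam : P → ℝ) (hlamS : ∀ p ∈ PS, 0 < lam p) (hlamU : ∀ p ∈ PU, lam p ≤ 0)
    (hlam : ∀ p, ∀ s : ℝ, 0 ≤ s → ∀ ξ : Fin d → ℝ,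
      (Pm p).mulVec ((NormedSpace.exp (s • A p)).mulVec ξ) ⬝ᵥ
          (NormedSpace.exp (s • A p)).mulVec ξ ≤
        Real.exp (-(lam p) * s) * ((Pm p).mulVec ξ ⬝ᵥ ξ))
    -- the constants μ̂_{pq}
    (mu : P × P → ℝ) (hmuone : ∀ e ∈ E, 1 ≤ mu e)
    (hmu : ∀ e ∈ E, ∀ ξ : Fin d → ℝ,
      (Pm e.2).mulVec ξ ⬝ᵥ ξ ≤ mu e * ((Pm e.1).mulVec ξ ⬝ᵥ ξ))
    -- the stability condition (limsup < 0)
    (hlimsup : limsup (fun t : ℝ =>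
      (N t / t) * ∑ e ∈ E, Real.log (mu e) *
          (((Finset.range (N t)).filter (fun i => σ i = e.1 ∧ σ (i + 1) = e.2)).card / (N t : ℝ))
        - ∑ p ∈ PS, |lam p| *
            ((∑ i ∈ Finset.range (N t + 1),
              if σ i = p then min (τ (i + 1)) t - τ i else 0) / t)
        + ∑ p ∈ PU, |lam p| *
            ((∑ i ∈ Finset.range (N t + 1),
              if σ i = p then min (τ (i + 1)) t - τ i else 0) / t)) atTop < 0) :
    -- conclusion: global asymptotic stability
    (∀ ε : ℝ, 0 < ε → ∃ δ : ℝ, 0 < δ ∧ ∀ x₀ : Fin d → ℝ,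
      ‖(WithLp.equiv 2 (Fin d → ℝ)).symm x₀‖ < δ →
        ∀ t : ℝ, 0 ≤ t →
          ‖(WithLp.equiv 2 (Fin d → ℝ)).symm
            ((NormedSpace.exp ((t - τ (N t)) • A (σ (N t))) *
              prodFlow A σ τ (N t)).mulVec x₀)‖ ≤ ε) ∧
    (∀ x₀ : Fin d → ℝ,
      Tendsto (fun t : ℝ => ‖(WithLp.equiv 2 (Fin d → ℝ)).symm
          ((NormedSpace.exp ((t - τ (N t)) • A (σ (N t))) *
            prodFlow A σ τ (N t)).mulVec x₀)‖) atTop (nhds 0)) := by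
  obtain ⟨c, C, hc, hC, hV⟩ := exists_quadForm_bounds Pm hPm
  set Ψ : ℝ → ℝ := fun t => logGain σ τ lam mu (N t) - lam (σ (N t)) * (t - τ (N t)) with hΨ
  set x : (Fin d → ℝ) → ℝ → (Fin d → ℝ) := fun x₀ t =>
    (NormedSpace.exp ((t - τ (N t)) • A (σ (N t))) * prodFlow A σ τ (N t)).mulVec x₀ with hx
  have hNle : ∀ t : ℝ, 0 ≤ t → τ (N t) ≤ t := fun t ht => (hN t ht _).2 le_rfl
  have hNlt : ∀ t : ℝ, 0 ≤ t → t < τ (N t + 1) := fun t ht =>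
    not_le.mp fun h => absurd ((hN t ht _).1 h) (by omega)
  have hdecay : ∀ x₀ : Fin d → ℝ, ∀ t : ℝ, 0 ≤ t →
      ‖(WithLp.equiv 2 (Fin d → ℝ)).symm (x x₀ t)‖ ^ 2 ≤
        C / c * Real.exp (Ψ t) * ‖(WithLp.equiv 2 (Fin d → ℝ)).symm x₀‖ ^ 2 := by
    intro x₀ t ht
    have hflow : (Pm (σ (N t))).mulVec (x x₀ t) ⬝ᵥ x x₀ t ≤
        Real.exp (Ψ t) * ((Pm (σ 0)).mulVec x₀ ⬝ᵥ x₀) := by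
      have hsplit : Real.exp (Ψ t) = Real.exp (-lam (σ (N t)) * (t - τ (N t))) *
          Real.exp (logGain σ τ lam mu (N t)) := by
        rw [← Real.exp_add]
        congr 1
        simp only [hΨ]
        ring
      simp only [hx]
      rw [hsplit, ← mulVec_mulVec, mul_assoc]
      exact (hlam _ _ (sub_nonneg.mpr (hNle t ht)) _).trans (mul_le_mul_of_nonneg_left
        (quadForm_prodFlow_le A E τ hτmono σ hσE Pm lam hlam mu hmuone hmu x₀ (N t))
        (Real.exp_nonneg _))
    have hchain := ((hV _ _).1.trans hflow).trans
      (mul_le_mul_of_nonneg_left (hV (σ 0) x₀).2 (Real.exp_nonneg (Ψ t)))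
    rw [mul_comm c, ← le_div_iff₀ hc] at hchain
    exact hchain.trans_eq (by ring)
  obtain ⟨a, ha0, ha⟩ := exists_neg_eventually_le_of_limsup_neg hlimsup
  have hrate : ∀ᶠ t : ℝ in atTop, Ψ t ≤ a * t := by
    filter_upwards [ha, eventually_gt_atTop 0] with t hta ht
    rw [← div_le_iff₀ ht]
    refine le_of_eq_of_le ?_ hta
    have hswitch : (N t / t) * ∑ e ∈ E, Real.log (mu e) *
        (((Finset.range (N t)).filter (fun i => σ i = e.1 ∧ σ (i + 1) = e.2)).card / (N t : ℝ)) =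
        (∑ i ∈ Finset.range (N t), Real.log (mu (σ i, σ (i + 1)))) / t := by
      rw [← sum_mul_transition_count E σ hσE (fun e => Real.log (mu e))]
      simp only [← mul_div_assoc]
      rw [← Finset.sum_div]
      rcases Nat.eq_zero_or_pos (N t) with h0 | h0
      · simp [h0]
      · have : (N t : ℝ) ≠ 0 := by positivity
        field_simp
    have hactive := signed_activation_sum PS PU hpart lam hlamS hlamU σ
      (fun i => min (τ (i + 1)) t - τ i) (N t + 1)
    have hdwell : ∑ i ∈ Finset.range (N t + 1), lam (σ i) * (min (τ (i + 1)) t - τ i) =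
        ∑ i ∈ Finset.range (N t), lam (σ i) * (τ (i + 1) - τ i) +
          lam (σ (N t)) * (t - τ (N t)) := by
      rw [Finset.sum_range_succ, min_eq_right (hNlt t ht.le).le]
      congr 1
      refine Finset.sum_congr rfl fun i hi => ?_
      rw [min_eq_left ((hN t ht.le _).2 (Finset.mem_range.mp hi))]
    rw [hswitch]
    simp only [← mul_div_assoc]
    rw [← Finset.sum_div, ← Finset.sum_div, ← sub_div, ← add_div, sub_eq_add_neg, add_assoc,
      hactive, hdwell]
    simp only [hΨ, logGain, Finset.sum_sub_distrib]
    ring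
  obtain ⟨B, hB⟩ : ∃ B : ℝ, ∀ t : ℝ, 0 ≤ t → Ψ t ≤ B := by
    obtain ⟨T, hT⟩ := eventually_atTop.mp (hrate.and (eventually_ge_atTop 0))
    have hT0 : 0 ≤ T := (hT T le_rfl).2
    set g : ℕ → ℝ := fun i =>
      Real.log (mu (σ i, σ (i + 1))) + |lam (σ i)| * (τ (i + 1) - τ i) with hg
    have hlog : ∀ i, 0 ≤ Real.log (mu (σ i, σ (i + 1))) := fun i =>
      Real.log_nonneg (hmuone _ (hσE i))
    have hstep : ∀ i, 0 ≤ τ (i + 1) - τ i := fun i =>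
      sub_nonneg.mpr (hτmono i.lt_succ_self).le
    have hg0 : ∀ i, 0 ≤ g i := fun i =>
      add_nonneg (hlog i) (mul_nonneg (abs_nonneg _) (hstep i))
    refine ⟨∑ i ∈ Finset.range (N T + 1), g i, fun t ht => ?_⟩
    rcases le_total T t with hTt | htT
    · exact ((hT t hTt).1.trans (mul_nonpos_of_nonpos_of_nonneg ha0.le ht)).trans
        (Finset.sum_nonneg fun i _ => hg0 i)
    · have hNN : N t ≤ N T := (hN T hT0 _).1 ((hNle t ht).trans htT)
      have hneg : ∀ p, -lam p ≤ |lam p| := fun p => neg_le_abs _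
      calc Ψ t ≤ ∑ i ∈ Finset.range (N t), g i + g (N t) := by
            simp only [hΨ, logGain, sub_eq_add_neg (G := ℝ) _ (_ * _), ← neg_mul]
            gcongr with i _
            · simp only [hg]
              gcongr
              · exact hstep i
              · exact hneg _
            · simp only [hg]
              have h1 := mul_le_mul_of_nonneg_right (hneg (σ (N t)))
                (sub_nonneg.mpr (hNle t ht))
              have h2 := mul_le_mul_of_nonneg_left
                (sub_le_sub_right (hNlt t ht).le (τ (N t))) (abs_nonneg (lam (σ (N t))))
              linarith [hlog (N t)]
        _ = ∑ i ∈ Finset.range (N t + 1), g i := (Finset.sum_range_succ _ _).symm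
        _ ≤ ∑ i ∈ Finset.range (N T + 1), g i :=
            Finset.sum_le_sum_of_subset_of_nonneg
              (Finset.range_mono (by omega)) fun i _ _ => hg0 i
  constructor
  · intro ε hε
    have hK : 0 < C / c * Real.exp B := by positivity
    refine ⟨ε / Real.sqrt (C / c * Real.exp B), by positivity, fun x₀ hx₀ t ht => ?_⟩
    rw [lt_div_iff₀ (Real.sqrt_pos.mpr hK)] at hx₀
    have hsq := pow_le_pow_left₀ (by positivity) hx₀.le 2
    rw [mul_pow, Real.sq_sqrt hK.le] at hsq
    refine le_of_sq_le_sq ?_ hε.le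
    calc _ ≤ _ := hdecay x₀ t ht
      _ ≤ C / c * Real.exp B * ‖(WithLp.equiv 2 (Fin d → ℝ)).symm x₀‖ ^ 2 := by
        gcongr
        exact hB t ht
      _ ≤ ε ^ 2 := by rwa [mul_comm]
  · intro x₀
    have hexp : Tendsto (fun t : ℝ => C / c * Real.exp (a * t) *
        ‖(WithLp.equiv 2 (Fin d → ℝ)).symm x₀‖ ^ 2) atTop (nhds 0) := by
      have := (Real.tendsto_exp_atBot.comp
        (tendsto_id.const_mul_atTop_of_neg ha0)).const_mul (C / c)
      simpa using this.mul_const (‖(WithLp.equiv 2 (Fin d → ℝ)).symm x₀‖ ^ 2)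
    have hsq : Tendsto (fun t : ℝ => ‖(WithLp.equiv 2 (Fin d → ℝ)).symm (x x₀ t)‖ ^ 2)
        atTop (nhds 0) := by
      refine tendsto_of_tendsto_of_tendsto_of_le_of_le' tendsto_const_nhds hexp
        (Eventually.of_forall fun t => sq_nonneg _) ?_
      filter_upwards [hrate, eventually_ge_atTop 0] with t hta ht
      refine (hdecay x₀ t ht).trans ?_
      gcongr
    simpa [Real.sqrt_sq (norm_nonneg _)] using hsq.sqrt
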